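/- Let V be a finite-dimensional real vector space and H a smooth linear action of the multiplicative monoid (ℝ,·) on V. Then for all natural numbers i ≠ j, the derivatives of H at 0 annihilate each other: H⁽ⁱ⁾(0) ∘ H⁽ʲ⁾(0) = 0. Consequently the projectors Q_i := (1/i!) H⁽ⁱ⁾(0) satisfy Q_i ∘ Q_j = 0 for i ≠ j. -/

import Mathlib

theorem clm_iteratedDeriv_comp {F G : Type*} [NormedAddCommGroup F] [NormedSpace ℝ F]
    [NormedAddCommGroup G] [NormedSpace ℝ G] (L : F →L[ℝ] G) (f : ℝ → F)
    (hf : ContDiff ℝ (⊤ : ℕ∞) f) (n : ℕ) (x : ℝ) :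
    iteratedDeriv n (fun t => L (f t)) x = L (iteratedDeriv n f x) := by
  have h := L.iteratedFDeriv_comp_left (x := x) (hf.contDiffAt) (i := n) (by exact_mod_cast le_top)
  have h2 := congrArg (fun m => m (fun _ => (1 : ℝ))) h
  exact h2

/-- Let `V` be a finite-dimensional real vector space and `H` a smooth
linear action of the multiplicative monoid `(ℝ, ·)` on `V`. Then for all natural numbers
`i ≠ j` the derivatives of `H` at `0` annihilate each other, `H⁽ⁱ⁾(0) ∘ H⁽ʲ⁾(0) = 0`;
consequently the projectors `Q_i := (1/i!) • H⁽ⁱ⁾(0)` satisfy `Q_i ∘ Q_j = 0` for `i ≠ j`. -/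
theorem monoid_action_derivs_annihilate
    {V : Type*} [NormedAddCommGroup V] [NormedSpace ℝ V] [FiniteDimensional ℝ V]
    (H : ℝ → (V →L[ℝ] V))
    (hsmooth : ContDiff ℝ (⊤ : ℕ∞) (fun p : ℝ × V => H p.1 p.2))
    (hone : H 1 = ContinuousLinearMap.id ℝ V)
    (hmul : ∀ t s : ℝ, H (t * s) = (H t).comp (H s)) :
    ∀ i j : ℕ, i ≠ j →
      (iteratedDeriv i H 0).comp (iteratedDeriv j H 0) = 0 ∧
      (((i.factorial : ℝ))⁻¹ • iteratedDeriv i H 0).comp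
          (((j.factorial : ℝ))⁻¹ • iteratedDeriv j H 0) = 0 := by
  intro i j hij
  have hH : ContDiff ℝ (⊤ : ℕ∞) H := by
    rw [contDiff_clm_apply_iff]
    intro y
    exact hsmooth.comp (contDiff_id.prodMk contDiff_const)
  have key : ∀ t : ℝ, (H t).comp (iteratedDeriv j H 0) = t ^ j • iteratedDeriv j H 0 := by
    intro t
    have h1 := clm_iteratedDeriv_comp (ContinuousLinearMap.compL ℝ V V V (H t)) H hH j 0
    have h2 : iteratedDeriv j (fun s => H (t * s)) 0 = t ^ j • iteratedDeriv j H 0 := by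
      have := congrFun (iteratedDeriv_comp_const_smul (n := j) (f := H)
        (hH.of_le (by exact_mod_cast le_top)) t) 0
      simpa using this
    simp only [ContinuousLinearMap.compL_apply, ← hmul] at h1
    rw [← h1, h2]
  have main : (iteratedDeriv i H 0).comp (iteratedDeriv j H 0) = 0 := by
    have h1 := clm_iteratedDeriv_comp
      ((ContinuousLinearMap.compL ℝ V V V).flip (iteratedDeriv j H 0)) H hH i 0
    simp only [ContinuousLinearMap.flip_apply, ContinuousLinearMap.compL_apply, key] at h1
    rw [← h1, iteratedDeriv_smul_const (by fun_prop), iteratedDeriv_fun_pow_zero]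
    simp [hij]
  refine ⟨main, ?_⟩
  rw [ContinuousLinearMap.smul_comp, ContinuousLinearMap.comp_smul, main]
  simp
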